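/- Let α, β, γ be linear maps on real sequences such that the upper triangular matrix operator T(ω,x) = (αω + βx, γx) is bounded on Z₂. Then: (a′) α restricts to a bounded operator on ℓ²; (g′) γ restricts to a bounded operator on ℓ²; and (k) α − γ restricts to a compact operator on ℓ², i.e., the image under α − γ of the unit ball of ℓ² is relatively compact in ℓ². -/

import Mathlib

open scoped BigOperators

noncomputable section

/-- Real sequences. -/
abbrev RSeq : Type := ℕ → ℝ

/-- Membership in ℓ². -/
def memL2 (x : RSeq) : Prop := Summable (fun n => (x n) ^ 2)

/-- The ℓ² norm. -/
noncomputable def l2norm (x : RSeq) : ℝ := Real.sqrt (∑' n, (x n) ^ 2)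

/-- The Kalton–Peck map, defined coordinatewise.  (In Lean, `Real.log 0 = 0` and
division by zero is zero, so the conventions `0·log 0 = 0` and `KP 0 = 0` hold.) -/
noncomputable def KP (x : RSeq) : RSeq := fun n => 2 * x n * Real.log (|x n| / l2norm x)

/-- Membership in the Kalton–Peck space Z₂. -/
def memZ2 (u : RSeq × RSeq) : Prop := memL2 u.2 ∧ memL2 (u.1 - KP u.2)

/-- The Z₂ quasinorm. -/
noncomputable def Z2norm (u : RSeq × RSeq) : ℝ := l2norm (u.1 - KP u.2) + l2norm u.2

/-- A map on pairs of sequences is bounded on Z₂. -/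
def BoundedOnZ2 (T : RSeq × RSeq → RSeq × RSeq) : Prop :=
  (∀ u, memZ2 u → memZ2 (T u)) ∧ ∃ C : ℝ, ∀ u, memZ2 u → Z2norm (T u) ≤ C * Z2norm u

/-- The matrix operator associated to four linear maps on sequences. -/
def matOp (α β δ γ : RSeq →ₗ[ℝ] RSeq) : RSeq × RSeq → RSeq × RSeq :=
  fun u => (α u.1 + β u.2, δ u.1 + γ u.2)

/-- Membership in the Orlicz space ℓ_f = Dom KP. -/
def memLf (x : RSeq) : Prop := memL2 x ∧ memL2 (KP x)

/-- The ℓ_f quasinorm. -/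
noncomputable def lfNorm (x : RSeq) : ℝ := l2norm (KP x) + l2norm x

/-- Membership in ℓ_f* = Ran KP. -/
def memLfStar (ω : RSeq) : Prop := ∃ x : RSeq, memL2 x ∧ memL2 (ω - KP x)

/-- The ℓ_f* quasinorm. -/
noncomputable def lfStarNorm (ω : RSeq) : ℝ :=
  sInf {r : ℝ | ∃ x : RSeq, memL2 x ∧ memL2 (ω - KP x) ∧ r = l2norm (ω - KP x) + l2norm x}

/-- A bounded map on Z₂ is strictly singular if every linear subspace of Z₂ on which it is
bounded below is finite dimensional. -/
def StrictlySingular (T : RSeq × RSeq → RSeq × RSeq) : Prop :=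
  ∀ V : Submodule ℝ (RSeq × RSeq), (∀ v ∈ V, memZ2 v) →
    (∃ c > 0, ∀ v ∈ V, c * Z2norm v ≤ Z2norm (T v)) → FiniteDimensional ℝ V

/-- A set of sequences is totally bounded (relatively compact) for the ℓ² norm. -/
def l2TotallyBounded (A : Set RSeq) : Prop :=
  ∀ ε > 0, ∃ S : Set RSeq, S.Finite ∧
    ∀ a ∈ A, ∃ s ∈ S, memL2 (a - s) ∧ l2norm (a - s) < ε

/-- A map on Z₂ is compact if the image of the unit ball is totally bounded for the
Z₂ quasinorm. -/
def CompactOnZ2 (T : RSeq × RSeq → RSeq × RSeq) : Prop :=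
  ∀ ε > 0, ∃ S : Set (RSeq × RSeq), S.Finite ∧
    ∀ u, memZ2 u → Z2norm u ≤ 1 → ∃ s ∈ S, memZ2 (T u - s) ∧ Z2norm (T u - s) < ε

theorem h_pos (x y : ℝ) (hx : 0 ≤ x) (hy : 0 ≤ y) :
    |2 * (x+y) * Real.log (x+y) - 2*x*Real.log x - 2*y*Real.log y| ≤ 8 * Real.sqrt (x*y) := by
  rcases hx.eq_or_lt with rfl | hx
  · simp
  rcases hy.eq_or_lt with rfl | hy
  · simp
  have key : ∀ x y : ℝ, 0 < x → 0 < y → 0 ≤ x * (Real.log (x+y) - Real.log x) ∧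
      x * (Real.log (x+y) - Real.log x) ≤ 2 * Real.sqrt (x*y) := by
    intro x y hx hy
    have e : Real.log (x+y) - Real.log x = 2 * Real.log (Real.sqrt ((x+y)/x)) := by
      rw [Real.log_sqrt (by positivity), Real.log_div (by positivity) (by positivity)]; ring
    constructor
    · have := Real.log_le_log hx (by linarith : x ≤ x+y)
      apply mul_nonneg hx.le; linarith
    · rw [e]
      set r := Real.sqrt ((x+y)/x) with hr
      have hrs : r^2 = (x+y)/x := Real.sq_sqrt (by positivity)
      have hr1 : 1 < r := by
        rw [hr, Real.lt_sqrt (by norm_num), lt_div_iff₀ hx]; linarith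
      
      have h1 : 2 * Real.log r ≤ 2 * Real.sqrt (r^2-1) := by
        have h2 := Real.log_le_sub_one_of_pos (x := r) (by linarith)
        have : r - 1 ≤ Real.sqrt (r^2-1) := Real.le_sqrt_of_sq_le (by nlinarith)
        linarith
      have h3 : Real.sqrt (x*y) = x * Real.sqrt (r^2-1) := by
        rw [hrs, show x*y = x^2*((x+y)/x-1) by field_simp; ring, Real.sqrt_mul (by positivity), Real.sqrt_sq hx.le]
      rw [h3]; nlinarith
  obtain ⟨a1, a2⟩ := key x y hx hy
  obtain ⟨b1, b2⟩ := key y x hy hx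
  rw [add_comm y x, mul_comm y x] at b2
  rw [add_comm y x] at b1
  rw [abs_le]; constructor <;> nlinarith

theorem h_all (x y : ℝ) :
    |2 * (x+y) * Real.log (x+y) - 2*x*Real.log x - 2*y*Real.log y| ≤ 8 * Real.sqrt (|x| * |y|) := by
  have mixed : ∀ x w : ℝ, 0 ≤ w → w ≤ x →
      |2 * (x+-w) * Real.log (x+-w) - 2*x*Real.log x - 2*(-w)*Real.log (-w)| ≤ 8 * Real.sqrt (x*w) := by
    intro x w hw hx
    have h1 := h_pos (x-w) w (by linarith) hw
    have h2 : Real.sqrt ((x-w)*w) ≤ Real.sqrt (x*w) := Real.sqrt_le_sqrt (by nlinarith)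
    rw [sub_add_cancel] at h1
    rw [Real.log_neg_eq_log, abs_sub_comm, ← sub_eq_add_neg] at *
    rw [abs_le] at *
    constructor <;> linarith [h1.1, h1.2]
  have flip : ∀ x y : ℝ, |2 * (-x+-y) * Real.log (-x+-y) - 2*(-x)*Real.log (-x) - 2*(-y)*Real.log (-y)| = |2 * (x+y) * Real.log (x+y) - 2*x*Real.log x - 2*y*Real.log y| := by
    intro x y
    rw [show -x + -y = -(x+y) by ring, Real.log_neg_eq_log, Real.log_neg_eq_log, Real.log_neg_eq_log, ← abs_neg]
    congr 1; ring
  have swap : ∀ x y : ℝ, |2 * (x+y) * Real.log (x+y) - 2*x*Real.log x - 2*y*Real.log y| = |2 * (y+x) * Real.log (y+x) - 2*y*Real.log y - 2*x*Real.log x| := by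
    intro x y
    rw [add_comm y x]; congr 1; ring
  rcases le_total 0 x with hx | hx <;> rcases le_total 0 y with hy | hy
  · rw [abs_of_nonneg hx, abs_of_nonneg hy]; exact h_pos x y hx hy
  · rw [abs_of_nonneg hx, abs_of_nonpos hy]
    rcases le_total (-y) x with h | h
    · have := mixed x (-y) (by linarith) h
      simpa only [neg_neg] using this
    · have := mixed (-y) x hx h
      rw [flip] at this
      rw [swap, mul_comm x (-y)]
      exact this
  · rw [abs_of_nonpos hx, abs_of_nonneg hy]
    rcases le_total (-x) y with h | h
    · have := mixed y (-x) (by linarith) h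
      rw [swap, mul_comm (-x)]
      simpa only [neg_neg] using this
    · have := mixed (-x) y hy h
      rw [← flip, neg_neg, neg_neg] at this
      exact this
  · rw [abs_of_nonpos hx, abs_of_nonpos hy, ← flip]
    exact h_pos (-x) (-y) (by linarith) (by linarith)

/-- The Hilbert space ℓ². -/
abbrev EL2 : Type := lp (fun _ : ℕ => ℝ) 2

theorem mem_iff (x : RSeq) : memL2 x ↔ Memℓp x 2 := by
  rw [memℓp_gen_iff (by norm_num)]
  simp [memL2]

theorem memL2_coe (x : EL2) : memL2 (x : RSeq) := (mem_iff _).2 x.2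

theorem norm_sq_E (x : EL2) : HasSum (fun n => (x n)^2) (‖x‖^2) := by
  have := lp.hasSum_norm (p := 2) (by norm_num) x
  simpa using this

theorem l2norm_coe (x : EL2) : l2norm (x : RSeq) = ‖x‖ := by
  rw [l2norm, (norm_sq_E x).tsum_eq, Real.sqrt_sq (norm_nonneg _)]

theorem l2norm_zero : l2norm 0 = 0 := by simp [l2norm]

theorem exists_E {x : RSeq} (hx : memL2 x) : ∃ y : EL2, (y : RSeq) = x :=
  ⟨⟨x, (mem_iff x).1 hx⟩, rfl⟩

theorem exists_E_of_sum {x : RSeq} {c : ℝ} (hc : 0 ≤ c)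
    (hx : ∀ s : Finset ℕ, ∑ k ∈ s, (x k)^2 ≤ c^2) : ∃ y : EL2, (y : RSeq) = x ∧ ‖y‖ ≤ c := by
  have h1 : memL2 x := summable_of_sum_le (fun _ => sq_nonneg _) hx
  obtain ⟨y, hy⟩ := exists_E h1
  refine ⟨y, hy, ?_⟩
  rw [← l2norm_coe, hy, l2norm]
  apply Real.sqrt_le_iff.2 ⟨hc, h1.tsum_le_of_sum_le hx⟩

/-- `t log t²`. -/
def hh (t : ℝ) : ℝ := 2 * t * Real.log t

/-- coordinatewise `t log t²`. -/
def HH (x : RSeq) : RSeq := fun n => hh (x n)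

theorem hh_abs (t : ℝ) (ht : 0 ≤ t) : |hh t| ≤ 2 + 2 * t^2 := by
  rcases ht.eq_or_lt with rfl | ht
  · simp [hh]
  rcases le_total t 1 with h | h
  · have := Real.abs_log_mul_self_lt t ht h
    have e : hh t = 2 * (Real.log t * t) := by rw [hh]; ring
    rw [e, abs_mul, abs_of_pos (by norm_num : (0:ℝ) < 2)]
    nlinarith
  · have h1 := Real.log_nonneg h
    have h2 := Real.log_le_sub_one_of_pos ht
    rw [hh, abs_of_nonneg (by positivity)]
    nlinarith

theorem KP_eq (x : EL2) : KP x = HH x - (2 * Real.log ‖x‖) • (x : RSeq) := by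
  funext n
  simp only [KP, HH, hh, l2norm_coe, Pi.sub_apply, Pi.smul_apply, smul_eq_mul]
  by_cases h : x n = 0
  · simp [h]
  · have : ‖x‖ ≠ 0 := by
      intro h0
      rw [norm_eq_zero] at h0
      apply h; simp [h0]
    rw [Real.log_div (by simpa using h) this, Real.log_abs]; ring

theorem HH_smul (c : ℝ) (x : RSeq) : HH (c • x) = c • HH x + (2 * c * Real.log c) • x := by
  funext n
  simp only [HH, hh, Pi.add_apply, Pi.smul_apply, smul_eq_mul]
  by_cases h : x n = 0
  · simp [h]
  by_cases hc : c = 0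
  · simp [hc]
  rw [Real.log_mul hc h]; ring

/-- The absolute values of x and y are almost orthogonal. -/
def RR (η : ℝ) (x y : RSeq) : Prop := ∀ s : Finset ℕ, ∑ k ∈ s, |x k| * |y k| ≤ η

theorem HH_add (S y : RSeq) (η : ℝ) (h : RR η S y) :
    ∃ e : EL2, (e : RSeq) = HH (S + y) - HH S - HH y ∧ ‖e‖ ≤ 8 * Real.sqrt η := by
  have hη : 0 ≤ η := by simpa using h ∅
  apply exists_E_of_sum (by positivity)
  intro s
  calc _ ≤ ∑ k ∈ s, 64 * (|S k| * |y k|) := by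
        gcongr with k hk
        have := h_all (S k) (y k)
        simp only [HH, hh, Pi.sub_apply, Pi.add_apply]
        rw [← sq_abs]
        calc _ ≤ (8 * Real.sqrt (|S k| * |y k|))^2 := by gcongr
          _ = _ := by rw [mul_pow, Real.sq_sqrt (by positivity)]; norm_num
    _ ≤ 64 * η := by rw [← Finset.mul_sum]; linarith [h s]
    _ = _ := by rw [mul_pow, Real.sq_sqrt hη]; norm_num

theorem HH_sum (y : ℕ → EL2) (ε : ℕ → ℝ) (hε : ∀ i, |ε i| = 1) (N : ℕ) (η : ℝ) (hη : 0 ≤ η)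
    (h : ∀ i j, i < j → RR η (y i) (y j)) : ∀ n ≤ N, ∃ e : EL2,
    (e : RSeq) = HH (∑ i ∈ Finset.range n, ε i • y i : EL2)
      - ∑ i ∈ Finset.range n, ε i • HH (y i) ∧ ‖e‖ ≤ n * (8 * Real.sqrt (N * η)) := by
  intro n
  induction n with
  | zero => intro _; refine ⟨0, ?_, by simp⟩; funext k; simp [HH, hh]
  | succ n ih =>
    intro hn
    obtain ⟨e, he, hne⟩ := ih (by omega)
    have hR : RR (N * η) (∑ i ∈ Finset.range n, ε i • y i : EL2) (ε n • y n : EL2) := by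
      intro s
      calc _ ≤ ∑ k ∈ s, ∑ i ∈ Finset.range n, |y i k| * |y n k| := by
            gcongr with k hk
            rw [← Finset.sum_mul]
            have e1 : (∑ i ∈ Finset.range n, ε i • y i : EL2) k
              = ∑ i ∈ Finset.range n, ε i * y i k := by
                rw [lp.coeFn_sum, Finset.sum_apply]; simp
            have e2 : (ε n • y n : EL2) k = ε n * y n k := by simp
            rw [e1, e2, abs_mul, hε, one_mul]
            gcongr
            refine (Finset.abs_sum_le_sum_abs _ _).trans (le_of_eq ?_)
            simp [abs_mul, hε]
        _ = ∑ i ∈ Finset.range n, ∑ k ∈ s, |y i k| * |y n k| := Finset.sum_comm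
        _ ≤ ∑ i ∈ Finset.range n, η := by
            gcongr with i hi
            exact h i n (Finset.mem_range.1 hi) s
        _ = n * η := by simp
        _ ≤ N * η := by gcongr; omega
    obtain ⟨e', he', hne'⟩ := HH_add _ _ _ hR
    refine ⟨e + e', ?_, ?_⟩
    · rw [lp.coeFn_add, he, he', Finset.sum_range_succ, Finset.sum_range_succ, lp.coeFn_add]
      have e3 : HH (ε n • y n : EL2) = ε n • HH (y n) := by
        rw [lp.coeFn_smul, HH_smul, ← Real.log_abs, hε]; simp
      rw [e3]; abel
    · push_cast
      linarith [norm_add_le e e']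

theorem RR_tail (x : EL2) (η C : ℝ) (hη : 0 < η) (hC : 0 ≤ C) : ∃ t : Finset ℕ,
    ∀ w : EL2, (∀ k ∈ t, w k = 0) → ‖w‖ ≤ C → RR η x w := by
  obtain ⟨t, ht⟩ := summable_iff_vanishing_norm.1 (norm_sq_E x).summable ((η / (C+1))^2) (by positivity)
  refine ⟨t, fun w hw hwC s => ?_⟩
  have h1 := ht (s \ t) Finset.sdiff_disjoint
  have h2 : ∑ k ∈ s, |x k| * |w k| = ∑ k ∈ s \ t, |x k| * |w k| := by
    symm
    apply Finset.sum_subset Finset.sdiff_subset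
    intro k hk hk'
    have : k ∈ t := by by_contra h; exact hk' (Finset.mem_sdiff.2 ⟨hk, h⟩)
    simp [hw k this]
  rw [h2]
  have h3 := Finset.sum_mul_sq_le_sq_mul_sq (s \ t) (fun k => |x k|) (fun k => |w k|)
  simp only [sq_abs] at h3
  have h4 : ∑ k ∈ s \ t, (w k)^2 ≤ C^2 :=
    (sum_le_hasSum _ (fun _ _ => sq_nonneg _) (norm_sq_E w)).trans (by gcongr)
  have h5 : ∑ k ∈ s \ t, (x k)^2 ≤ (η / (C+1))^2 := (le_abs_self _).trans h1.le
  apply le_of_sq_le_sq _ hη.le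
  calc _ ≤ _ := h3
    _ ≤ (η / (C+1))^2 * C^2 := by gcongr
    _ = (η * (C / (C+1)))^2 := by ring
    _ ≤ η^2 := by
      have : C / (C+1) ≤ 1 := by rw [div_le_one (by positivity)]; linarith
      gcongr
      nlinarith

theorem signs {V W : Type*} [NormedAddCommGroup V] [InnerProductSpace ℝ V]
    [NormedAddCommGroup W] [InnerProductSpace ℝ W] (f : ℕ → V) (g : ℕ → W) (l : ℝ) (N : ℕ) :
    ∃ ε : ℕ → ℝ, (∀ i, |ε i| = 1) ∧
      ∑ i ∈ Finset.range N, (l * ‖f i‖^2 - ‖g i‖^2) ≤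
        l * ‖∑ i ∈ Finset.range N, ε i • f i‖^2 - ‖∑ i ∈ Finset.range N, ε i • g i‖^2 := by
  induction N with
  | zero => exact ⟨fun _ => 1, by simp, by simp⟩
  | succ n ih =>
    obtain ⟨ε, hε, h⟩ := ih
    have key : ∃ c : ℝ, |c| = 1 ∧ ∑ i ∈ Finset.range (n+1), (l * ‖f i‖^2 - ‖g i‖^2) ≤
        l * ‖∑ i ∈ Finset.range n, ε i • f i + c • f n‖^2
          - ‖∑ i ∈ Finset.range n, ε i • g i + c • g n‖^2 := by
      rw [Finset.sum_range_succ]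
      by_contra hcon
      push Not at hcon
      have h1 := hcon 1 (by simp)
      have h2 := hcon (-1) (by simp)
      simp only [one_smul, neg_smul, ← sub_eq_add_neg] at h1 h2
      have p1 := parallelogram_law_with_norm ℝ (∑ i ∈ Finset.range n, ε i • f i) (f n)
      have p2 := parallelogram_law_with_norm ℝ (∑ i ∈ Finset.range n, ε i • g i) (g n)
      have p3 := congrArg (fun t => l * t) p1
      nlinarith
    obtain ⟨c, hc, hk⟩ := key
    refine ⟨fun i => if i = n then c else ε i, ?_, ?_⟩
    · intro i; dsimp only; split_ifs <;> simp [hc, hε]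
    · rw [Finset.sum_range_succ (fun i => (if i = n then c else ε i) • f i),
        Finset.sum_range_succ (fun i => (if i = n then c else ε i) • g i)]
      have a1 : ∑ i ∈ Finset.range n, (if i = n then c else ε i) • f i = ∑ i ∈ Finset.range n, ε i • f i :=
        Finset.sum_congr rfl fun i hi => by rw [if_neg (Finset.mem_range.1 hi).ne]
      have a2 : ∑ i ∈ Finset.range n, (if i = n then c else ε i) • g i = ∑ i ∈ Finset.range n, ε i • g i :=
        Finset.sum_congr rfl fun i hi => by rw [if_neg (Finset.mem_range.1 hi).ne]
      rw [a1, a2]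
      simpa using hk

theorem norm_sum_orth (u : ℕ → EL2) (hu : ∀ i, ‖u i‖ ≤ 1) (ho : ∀ i j, i < j → inner ℝ (u i) (u j) = 0)
    (ε : ℕ → ℝ) (hε : ∀ i, |ε i| = 1) (N : ℕ) : ‖∑ i ∈ Finset.range N, ε i • u i‖^2 ≤ N := by
  induction N with
  | zero => simp
  | succ n ih =>
    rw [Finset.sum_range_succ, norm_add_sq_real]
    have : inner ℝ (∑ i ∈ Finset.range n, ε i • u i) (ε n • u n) = 0 := by
      rw [sum_inner]
      apply Finset.sum_eq_zero
      intro i hi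
      rw [inner_smul_left, inner_smul_right, ho i n (Finset.mem_range.1 hi)]; simp
    rw [this, norm_smul, Real.norm_eq_abs, hε, one_mul]
    push_cast
    nlinarith [hu n, norm_nonneg (u n)]

theorem compact_dichotomy (D : EL2 →L[ℝ] EL2) (δ : ℝ) (hδ : 0 < δ) (F : Submodule ℝ EL2)
    [FiniteDimensional ℝ F] (hF : ∀ u ∈ Fᗮ, ‖u‖ ≤ 1 → ‖D u‖ < δ) :
    ∃ S : Set EL2, S.Finite ∧ ∀ y : EL2, ‖y‖ ≤ 1 → ∃ s ∈ S, ‖D y - s‖ < 2 * δ := by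
  have hc : IsCompact ((fun v : F => D v) '' Metric.closedBall 0 1) :=
    (isCompact_closedBall _ _).image (D.continuous.comp continuous_subtype_val)
  obtain ⟨S, hS, hS2⟩ := Metric.totallyBounded_iff.1 hc.totallyBounded δ hδ
  refine ⟨S, hS, fun y hy => ?_⟩
  have h1 : D (F.starProjection y) ∈ ((fun v : F => D v) '' Metric.closedBall 0 1) := by
    refine ⟨⟨F.starProjection y, F.starProjection_apply_mem y⟩, ?_, rfl⟩
    rw [mem_closedBall_zero_iff]
    exact (F.norm_starProjection_apply_le y).trans hy
  have h2 := hS2 h1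
  simp only [Set.mem_iUnion, Metric.mem_ball, dist_eq_norm] at h2
  obtain ⟨s, hs, hs2⟩ := h2
  refine ⟨s, hs, ?_⟩
  have h3 : y - F.starProjection y ∈ Fᗮ := F.sub_starProjection_mem_orthogonal y
  have h4 : ‖y - F.starProjection y‖ ≤ 1 := by
    rw [← F.starProjection_orthogonal_val]
    exact (Fᗮ.norm_starProjection_apply_le y).trans hy
  have h5 := hF _ h3 h4
  have : D y - s = D (y - F.starProjection y) + (D (F.starProjection y) - s) := by
    rw [map_sub]; abel
  rw [this]
  linarith [norm_add_le (D (y - F.starProjection y)) (D (F.starProjection y) - s)]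

theorem orth_coord (Γ : EL2 →L[ℝ] EL2) (u : EL2) (k : ℕ)
    (h : inner ℝ (ContinuousLinearMap.adjoint Γ (lp.single 2 k (1:ℝ))) u = 0) : Γ u k = 0 := by
  rw [ContinuousLinearMap.adjoint_inner_left, lp.inner_single_left] at h
  simpa using h

theorem selection (D Γ : EL2 →L[ℝ] EL2) (δ : ℝ)
    (hD : ∀ F : Submodule ℝ EL2, FiniteDimensional ℝ F → ∃ u ∈ Fᗮ, ‖u‖ ≤ 1 ∧ δ ≤ ‖D u‖)
    (η : ℝ) (hη : 0 < η) : ∃ u : ℕ → EL2, (∀ i, ‖u i‖ ≤ 1 ∧ δ ≤ ‖D (u i)‖) ∧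
      ∀ i j, i < j → inner ℝ (u i) (u j) = 0 ∧ RR η (u i) (u j) ∧ RR η (Γ (u i)) (Γ (u j)) := by
  apply exists_seq_of_forall_finset_exists (fun u : EL2 => ‖u‖ ≤ 1 ∧ δ ≤ ‖D u‖)
    (fun x y => inner ℝ x y = 0 ∧ RR η x y ∧ RR η (Γ x) (Γ y))
  intro s _
  classical
  choose t ht using fun x : EL2 => RR_tail x η (‖Γ‖ + 1) hη (by positivity)
  let A : Finset EL2 := s ∪ (s.biUnion fun x =>
    (t x).image (fun k => (lp.single 2 k (1:ℝ) : EL2)) ∪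
    (t (Γ x)).image (fun k => ContinuousLinearMap.adjoint Γ (lp.single 2 k (1:ℝ) : EL2)))
  obtain ⟨u, hu, hu1, hu2⟩ := hD (Submodule.span ℝ (A : Set EL2))
    (FiniteDimensional.span_finset ℝ A)
  have ho : ∀ a ∈ A, inner ℝ a u = 0 := fun a ha =>
    (Submodule.mem_orthogonal _ _).1 hu a (Submodule.subset_span ha)
  refine ⟨u, ⟨hu1, hu2⟩, fun x hx => ⟨ho x (by simp [A, hx]), ?_, ?_⟩⟩
  · apply ht x u
    · intro k hk
      have := ho (lp.single 2 k (1:ℝ)) (by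
        simp only [A, Finset.mem_union, Finset.mem_biUnion, Finset.mem_image]
        exact Or.inr ⟨x, hx, Or.inl ⟨k, hk, rfl⟩⟩)
      rw [lp.inner_single_left] at this
      simpa using this
    · linarith [norm_nonneg Γ]
  · apply ht (Γ x) (Γ u)
    · intro k hk
      apply orth_coord
      exact ho _ (by
        simp only [A, Finset.mem_union, Finset.mem_biUnion, Finset.mem_image]
        exact Or.inr ⟨x, hx, Or.inr ⟨k, hk, rfl⟩⟩)
    · have := Γ.le_opNorm u
      nlinarith [norm_nonneg Γ]

theorem mkCLM (α : RSeq →ₗ[ℝ] RSeq) (C : ℝ)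
    (h : ∀ y : RSeq, memL2 y → memL2 (α y) ∧ l2norm (α y) ≤ C * l2norm y) :
    ∃ A : EL2 →L[ℝ] EL2, ∀ x : EL2, (A x : RSeq) = α x := by
  choose f hf using fun x : EL2 => exists_E (h x (memL2_coe x)).1
  let L : EL2 →ₗ[ℝ] EL2 :=
    { toFun := f
      map_add' := fun x y => by
        apply lp.ext; rw [lp.coeFn_add, hf, hf, hf, lp.coeFn_add, map_add]
      map_smul' := fun c x => by
        apply lp.ext; rw [RingHom.id_apply, lp.coeFn_smul, hf, hf, lp.coeFn_smul, map_smul] }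
  refine ⟨L.mkContinuous C fun x => ?_, hf⟩
  have := (h x (memL2_coe x)).2
  rw [l2norm_coe, ← hf, l2norm_coe] at this
  exact this

theorem G_bound (α β γ : RSeq →ₗ[ℝ] RSeq)
    (hT : BoundedOnZ2 (fun u : RSeq × RSeq => (α u.1 + β u.2, γ u.2)))
    (A Γ : EL2 →L[ℝ] EL2) (hA : ∀ x : EL2, (A x : RSeq) = α x) (hΓ : ∀ x : EL2, (Γ x : RSeq) = γ x) :
    ∃ K : ℝ, ∀ x : EL2, ‖x‖ ≤ 1 → ∃ g : EL2, (g : RSeq) = α (HH x) + β x - HH (Γ x) ∧ ‖g‖ ≤ K := by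
  obtain ⟨hm, C, hC⟩ := hT
  refine ⟨|C| + ‖A‖ * 4 + (2 + 2 * ‖Γ‖^2), fun x hx => ?_⟩
  have hz : memZ2 (KP x, (x : RSeq)) := ⟨memL2_coe x, by
    simp only [sub_self]; exact memL2_coe 0⟩
  have hn : Z2norm (KP x, (x : RSeq)) = ‖x‖ := by
    have : l2norm 0 = 0 := l2norm_zero
    simp only [Z2norm, sub_self, l2norm_coe, this, zero_add]
  have h1 := (hm _ hz).2
  have h2 := hC _ hz
  rw [hn] at h2
  dsimp only at h1
  simp only [Z2norm] at h2
  rw [← hΓ] at h1 h2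
  obtain ⟨g0, hg0⟩ := exists_E h1
  rw [← hg0, l2norm_coe, l2norm_coe] at h2
  have hg0n : ‖g0‖ ≤ |C| := by
    have : C * ‖x‖ ≤ |C| := by
      calc C * ‖x‖ ≤ |C| * ‖x‖ := by gcongr; exact le_abs_self C
        _ ≤ |C| := by nlinarith [abs_nonneg C]
    linarith [norm_nonneg (Γ x)]
  have hAx : ‖(2 * Real.log ‖x‖) • A x‖ ≤ ‖A‖ * 4 := by
    rw [norm_smul, Real.norm_eq_abs]
    have a1 := hh_abs ‖x‖ (norm_nonneg _)
    have a2 : |hh ‖x‖| = |2 * Real.log ‖x‖| * ‖x‖ := by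
      rw [hh, show 2 * ‖x‖ * Real.log ‖x‖ = (2 * Real.log ‖x‖) * ‖x‖ by ring, abs_mul, abs_norm]
    calc _ ≤ |2 * Real.log ‖x‖| * (‖A‖ * ‖x‖) := by gcongr; exact A.le_opNorm x
      _ = ‖A‖ * |hh ‖x‖| := by rw [a2]; ring
      _ ≤ _ := by gcongr; nlinarith [norm_nonneg x]
  have hGx : ‖(2 * Real.log ‖Γ x‖) • Γ x‖ ≤ 2 + 2 * ‖Γ‖^2 := by
    rw [norm_smul, Real.norm_eq_abs]
    have a1 := hh_abs ‖Γ x‖ (norm_nonneg _)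
    have a2 : |hh ‖Γ x‖| = |2 * Real.log ‖Γ x‖| * ‖Γ x‖ := by
      rw [hh, show 2 * ‖Γ x‖ * Real.log ‖Γ x‖ = (2 * Real.log ‖Γ x‖) * ‖Γ x‖ by ring, abs_mul, abs_norm]
    have a3 : ‖Γ x‖ ≤ ‖Γ‖ := (Γ.le_opNorm x).trans (by nlinarith [norm_nonneg Γ])
    have a4 : ‖Γ x‖^2 ≤ ‖Γ‖^2 := by gcongr
    rw [← a2]; linarith
  refine ⟨g0 + (2 * Real.log ‖x‖) • A x - (2 * Real.log ‖Γ x‖) • Γ x, ?_, ?_⟩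
  · rw [lp.coeFn_sub, lp.coeFn_add, lp.coeFn_smul, lp.coeFn_smul, hg0, KP_eq, KP_eq, hA, map_sub, map_smul]
    abel
  · have b1 := norm_sub_le (g0 + (2 * Real.log ‖x‖) • A x) ((2 * Real.log ‖Γ x‖) • Γ x)
    have b2 := norm_add_le g0 ((2 * Real.log ‖x‖) • A x)
    linarith

theorem final_arith (κ d G r K l N : ℝ) (hκ : 0 < κ) (hd : 0 ≤ d) (hr : 0 < r) (hK : 0 < K)
    (hr2 : r^2 = N) (hl : 2 * κ < l) (hs : N * K^2 + G^2 ≤ κ^2 * d^2) (hb : l * d ≤ G + r * K) :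
    False := by
  have hd0 : 0 ≤ κ * d := by positivity
  have q1 : G ≤ κ * d := by
    apply le_of_sq_le_sq _ hd0
    rw [mul_pow]; nlinarith [mul_nonneg (sq_nonneg r) (sq_nonneg K)]
  have q2 : r * K ≤ κ * d := by
    apply le_of_sq_le_sq _ hd0
    rw [mul_pow, mul_pow, hr2]; nlinarith [sq_nonneg G]
  have hpos : 0 < d := by
    have : 0 < κ * d := lt_of_lt_of_le (by positivity) q2
    exact pos_of_mul_pos_right this hκ.le
  nlinarith

set_option maxHeartbeats 1000000 in
theorem core (α β γ : RSeq →ₗ[ℝ] RSeq) (A Γ : EL2 →L[ℝ] EL2)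
    (hA : ∀ x : EL2, (A x : RSeq) = α x) (hΓ : ∀ x : EL2, (Γ x : RSeq) = γ x) (K0 : ℝ)
    (hK0 : ∀ x : EL2, ‖x‖ ≤ 1 → ∃ g : EL2, (g : RSeq) = α (HH x) + β x - HH (Γ x) ∧ ‖g‖ ≤ K0)
    (δ : ℝ) (hδ : 0 < δ)
    (hD : ∀ F : Submodule ℝ EL2, FiniteDimensional ℝ F → ∃ u ∈ Fᗮ, ‖u‖ ≤ 1 ∧ δ ≤ ‖(A - Γ) u‖) :
    False := by
  have hK00 : 0 ≤ K0 := by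
    obtain ⟨g, _, h⟩ := hK0 0 (by simp)
    exact (norm_nonneg g).trans h
  set K : ℝ := K0 + 8 * ‖A‖ + 8 with hK
  have hKp : 0 < K := by positivity
  set κ : ℝ := 2 * K / δ with hκ
  have hκp : 0 < κ := by positivity
  obtain ⟨N, hN1, hNlog⟩ : ∃ N : ℕ, 1 ≤ N ∧ 2 * κ < Real.log N := by
    have h1 := (Real.tendsto_log_atTop.comp tendsto_natCast_atTop_atTop).eventually_gt_atTop (2 * κ)
    obtain ⟨N, h2, h3⟩ := (h1.and (Filter.eventually_ge_atTop 1)).exists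
    exact ⟨N, h3, h2⟩
  have hNp : (0:ℝ) < N := by exact_mod_cast hN1
  obtain ⟨u, hu, hur⟩ := selection (A - Γ) Γ δ hD (1 / (N:ℝ)^3) (by positivity)
  choose g hg hgn using fun i => hK0 (u i) (hu i).1
  obtain ⟨ε, hε, hsig⟩ := signs (fun i => (A - Γ) (u i)) g (κ^2) N
  set S : EL2 := ∑ i ∈ Finset.range N, ε i • u i with hS
  have hDS : ∑ i ∈ Finset.range N, ε i • (A - Γ) (u i) = (A - Γ) S := by
    rw [hS, map_sum]; simp only [map_smul]
  have hΓS : ∑ i ∈ Finset.range N, ε i • Γ (u i) = Γ S := by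
    rw [hS, map_sum]; simp only [map_smul]
  set Gs : EL2 := ∑ i ∈ Finset.range N, ε i • g i with hGs
  rw [hDS] at hsig
  have hsig2 : (N:ℝ) * K^2 + ‖Gs‖^2 ≤ κ^2 * ‖(A - Γ) S‖^2 := by
    have : ∑ i ∈ Finset.range N, K^2 ≤
        ∑ i ∈ Finset.range N, (κ^2 * ‖(A - Γ) (u i)‖^2 - ‖g i‖^2) := by
      gcongr with i hi
      have e1 : (κ * δ)^2 ≤ (κ * ‖(A - Γ) (u i)‖)^2 := by
        gcongr; exact (hu i).2
      have e2 : κ * δ = 2 * K := by rw [hκ]; field_simp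
      have e3 : ‖g i‖^2 ≤ K^2 := by
        gcongr
        have := hgn i
        linarith [norm_nonneg A]
      rw [e2, mul_pow κ] at e1
      nlinarith
    simp only [Finset.sum_const, Finset.card_range, nsmul_eq_mul] at this
    linarith
  have hsq : Real.sqrt ((N:ℝ) * (1 / (N:ℝ)^3)) = 1 / N := by
    rw [show (N:ℝ) * (1 / (N:ℝ)^3) = (1/N)^2 by field_simp, Real.sqrt_sq (by positivity)]
  have hN8 : (N:ℝ) * (8 * (1 / (N:ℝ))) = 8 := by field_simp
  obtain ⟨e1, he1, hn1⟩ := HH_sum u ε hε N (1 / (N:ℝ)^3) (by positivity)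
    (fun i j hij => (hur i j hij).2.1) N le_rfl
  obtain ⟨e2, he2, hn2⟩ := HH_sum (fun i => Γ (u i)) ε hε N (1 / (N:ℝ)^3) (by positivity)
    (fun i j hij => (hur i j hij).2.2) N le_rfl
  rw [hsq, hN8] at hn1 hn2
  rw [← hS] at he1
  rw [hΓS] at he2
  have hSn := norm_sum_orth u (fun i => (hu i).1) (fun i j hij => (hur i j hij).1) ε hε N
  rw [← hS] at hSn
  set r : ℝ := Real.sqrt N with hr
  have hrp : 0 < r := Real.sqrt_pos.2 hNp
  have hr2 : r^2 = N := Real.sq_sqrt hNp.le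
  have hr1 : 1 ≤ r := by
    rw [hr, Real.one_le_sqrt]; exact_mod_cast hN1
  have hx1 : ‖r⁻¹ • S‖ ≤ 1 := by
    rw [norm_smul, norm_inv, Real.norm_eq_abs, abs_of_pos hrp, inv_mul_le_one₀ hrp]
    apply le_of_sq_le_sq _ hrp.le
    rw [hr2]; exact hSn
  obtain ⟨G, hG, hGn⟩ := hK0 _ hx1
  -- the main identity
  have hlog : Real.log r⁻¹ = - (Real.log N / 2) := by
    rw [Real.log_inv, hr, Real.log_sqrt hNp.le]
  have hmain : Real.log N • (A - Γ) S = Gs + A e1 - e2 - r • G := by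
    apply lp.ext
    have hGs' : (Gs : RSeq) = ∑ i ∈ Finset.range N, ε i • (α (HH (u i)) + β (u i) - HH (Γ (u i))) := by
      rw [hGs, lp.coeFn_sum]
      apply Finset.sum_congr rfl
      intro i _
      rw [lp.coeFn_smul, hg]
    have hβ : β S = ∑ i ∈ Finset.range N, ε i • β (u i) := by
      rw [hS, lp.coeFn_sum, map_sum]
      apply Finset.sum_congr rfl
      intro i _
      rw [lp.coeFn_smul, map_smul]
    have hαe : α e1 = α (HH S) - ∑ i ∈ Finset.range N, ε i • α (HH (u i)) := by
      rw [he1, map_sub, map_sum]; simp only [map_smul]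
    have hG' : r • (G : RSeq) = α (HH S) + β S - HH (Γ S)
        - Real.log N • ((A S : RSeq) - (Γ S : RSeq)) := by
      rw [hG, map_smul, lp.coeFn_smul, lp.coeFn_smul, HH_smul, HH_smul, hlog, hA,
        map_add, map_smul, map_smul, map_smul]
      funext n
      simp only [Pi.add_apply, Pi.sub_apply, Pi.smul_apply, smul_eq_mul]
      field_simp
      ring
    rw [lp.coeFn_smul, sub_apply, lp.coeFn_sub, lp.coeFn_sub, lp.coeFn_sub,
      lp.coeFn_add, lp.coeFn_smul, hG', hA e1, hαe, he2, hβ, hGs']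
    simp only [smul_add, smul_sub, Finset.sum_add_distrib, Finset.sum_sub_distrib]
    abel
  have hlogp : 0 < Real.log N := by linarith
  have hbd : Real.log N * ‖(A - Γ) S‖ ≤ ‖Gs‖ + r * K := by
    have c0 : ‖Real.log N • (A - Γ) S‖ = Real.log N * ‖(A - Γ) S‖ := by
      rw [norm_smul, Real.norm_eq_abs, abs_of_pos hlogp]
    rw [← c0, hmain]
    have c1 := norm_sub_le (Gs + A e1 - e2) (r • G)
    have c2 := norm_sub_le (Gs + A e1) e2
    have c3 := norm_add_le Gs (A e1)
    have c4 : ‖A e1‖ ≤ ‖A‖ * 8 := (A.le_opNorm e1).trans (by gcongr)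
    have c5 : ‖r • G‖ ≤ r * K0 := by
      rw [norm_smul, Real.norm_eq_abs, abs_of_pos hrp]; gcongr
    have c6 : ‖A‖ * 8 + 8 ≤ r * (‖A‖ * 8 + 8) := le_mul_of_one_le_left (by positivity) hr1
    have c7 : r * K = r * K0 + r * (‖A‖ * 8 + 8) := by rw [hK]; ring
    linarith
  exact final_arith κ _ _ r K _ N hκp (norm_nonneg _) hrp hKp hr2 hNlog hsig2 hbd

/-- If the upper triangular operator T(ω,x) = (αω + βx, γx) is bounded on Z₂
then α and γ restrict to bounded operators on ℓ² and α − γ restricts to a compact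
operator on ℓ². -/
theorem stmt_10 (α β γ : RSeq →ₗ[ℝ] RSeq)
    (hT : BoundedOnZ2 (fun u : RSeq × RSeq => (α u.1 + β u.2, γ u.2))) :
    (∃ C : ℝ, ∀ y : RSeq, memL2 y → memL2 (α y) ∧ l2norm (α y) ≤ C * l2norm y) ∧
    (∃ C : ℝ, ∀ y : RSeq, memL2 y → memL2 (γ y) ∧ l2norm (γ y) ≤ C * l2norm y) ∧
    l2TotallyBounded {z : RSeq | ∃ y : RSeq, memL2 y ∧ l2norm y ≤ 1 ∧ z = α y - γ y} := by
  have ha : ∃ C : ℝ, ∀ y : RSeq, memL2 y → memL2 (α y) ∧ l2norm (α y) ≤ C * l2norm y := by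
    obtain ⟨hm, C, hC⟩ := hT
    refine ⟨C, fun y hy => ?_⟩
    have hKP : KP 0 = 0 := by funext n; simp [KP]
    have hz : memZ2 (y, 0) := ⟨memL2_coe 0, by simpa [hKP] using hy⟩
    have h0 : l2norm 0 = 0 := l2norm_zero
    have h1 := (hm _ hz).2
    have h2 := hC _ hz
    simp only [map_zero, add_zero, hKP, sub_zero, Z2norm, h0] at h1 h2
    exact ⟨h1, h2⟩
  have hg : ∃ C : ℝ, ∀ y : RSeq, memL2 y → memL2 (γ y) ∧ l2norm (γ y) ≤ C * l2norm y := by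
    obtain ⟨hm, C, hC⟩ := hT
    refine ⟨C, fun y hy => ?_⟩
    have hz : memZ2 (KP y, y) := ⟨hy, by simp only [sub_self]; exact memL2_coe 0⟩
    have h0 : l2norm 0 = 0 := l2norm_zero
    refine ⟨(hm _ hz).1, ?_⟩
    have h2 := hC _ hz
    simp only [Z2norm, sub_self, h0, zero_add] at h2
    have : 0 ≤ l2norm (α (KP y) + β y - KP (γ y)) := Real.sqrt_nonneg _
    linarith
  refine ⟨ha, hg, ?_⟩
  obtain ⟨Ca, ha⟩ := ha
  obtain ⟨Cg, hg⟩ := hg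
  obtain ⟨A, hA⟩ := mkCLM α Ca ha
  obtain ⟨Γ, hΓ⟩ := mkCLM γ Cg hg
  obtain ⟨K0, hK0⟩ := G_bound α β γ hT A Γ hA hΓ
  intro ε hε
  have hD : ∃ F : Submodule ℝ EL2, FiniteDimensional ℝ F ∧
      ∀ u ∈ Fᗮ, ‖u‖ ≤ 1 → ‖(A - Γ) u‖ < ε / 2 := by
    by_contra hcon
    push Not at hcon
    exact core α β γ A Γ hA hΓ K0 hK0 (ε / 2) (by positivity) hcon
  obtain ⟨F, hF, hFD⟩ := hD
  obtain ⟨S, hS, hS2⟩ := compact_dichotomy (A - Γ) (ε / 2) (by positivity) F hFD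
  refine ⟨(fun s : EL2 => (s : RSeq)) '' S, hS.image _, ?_⟩
  rintro a ⟨y, hy, hy1, rfl⟩
  obtain ⟨y, rfl⟩ := exists_E hy
  rw [l2norm_coe] at hy1
  obtain ⟨s, hs, hs2⟩ := hS2 y hy1
  have e : α y - γ y - (s : RSeq) = ((A - Γ) y - s : EL2) := by
    rw [lp.coeFn_sub, sub_apply, lp.coeFn_sub, hA, hΓ]
  refine ⟨s, ⟨s, hs, rfl⟩, ?_, ?_⟩
  · rw [e]; exact memL2_coe _
  · rw [e, l2norm_coe]; linarith
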